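/- arXiv:1307.7986 — 2 statements merged into one kernel-verified Lean document; each statement's English description precedes it below -/
import Mathlib

section
/- Let c = (c₁,…,cₙ) ∈ 𝒜⁺ be dense and let e be an ear of c. Then there exists i ∈ {1,…,n} with e ∈ m_i. -/
open Matrix Finset

/-- The matrix `η(a)` with rows `(a, -1)` and `(1, 0)`. -/
def etaM (a : ℤ) : Matrix (Fin 2) (Fin 2) ℤ := !![a, -1; 1, 0]

/-- The set `𝒜⁺` of η-sequences, as an inductive predicate on lists of integers. -/
inductive IsEta : List ℤ → Prop
  | base : IsEta [0, 0]
  | rotate {c : List ℤ} : IsEta c → IsEta (c.rotate 1)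
  | reverse {c : List ℤ} : IsEta c → IsEta c.reverse
  | expand {a b : ℤ} {t : List ℤ} : IsEta (a :: b :: t) → IsEta ((a + 1) :: 1 :: (b + 1) :: t)

/-- The `i`-th entry (1-indexed) of a sequence. -/
def entryOf (c : List ℤ) (i : ℕ) : ℤ := c.getD (i - 1) 0

/-- `φ_i(j)`: `0` if `i = j`; the (2,1)-entry of `η(c_i)⋯η(c_{j-1})` if `i < j`;
the (2,1)-entry of `η(c_j)⋯η(c_{i-1})` if `j < i`.  (Indices are 1-based.) -/
def phi (c : List ℤ) (i j : ℕ) : ℤ :=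
  if i = j then 0
  else if i < j then (((c.drop (i - 1)).take (j - i)).map etaM).prod 1 0
  else (((c.drop (j - 1)).take (i - j)).map etaM).prod 1 0

open Classical in
/-- `m_i`: the set of positions `j ∈ {1,…,n}` where `φ_i` attains its maximum. -/
noncomputable def mset (c : List ℤ) (i : ℕ) : Finset ℕ :=
  (Finset.Icc 1 c.length).filter (fun j => ∀ l ∈ Finset.Icc 1 c.length, phi c i l ≤ phi c i j)

/-- `i ⊕ k`: addition of 1-based indices, wrapping around modulo `n` (for `i + k ≤ 2n`). -/
def addIdx (n i k : ℕ) : ℕ := if i + k ≤ n then i + k else i + k - n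

/-- `c` is dense if for every `i ∈ {1,…,n}`, `|m_i| > 1` or `|m_{i+1}| > 1`
(indices taken cyclically). -/
def DenseSeq (c : List ℤ) : Prop :=
  ∀ i ∈ Finset.Icc 1 c.length,
    1 < (mset c i).card ∨ 1 < (mset c (addIdx c.length i 1)).card

/-- `c` is fan-shaped if a cyclic rotation of `c` equals `(n-2, 1, 2, …, 2, 1)`. -/
def IsFan (c : List ℤ) : Prop :=
  ∃ k, c.rotate k =
    ((c.length : ℤ) - 2) :: 1 :: (List.replicate (c.length - 3) (2 : ℤ) ++ [1])

/-- The product `η(c₁)⋯η(cₙ)` over a list. -/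
def etaProd (s : List ℤ) : Matrix (Fin 2) (Fin 2) ℤ := (s.map etaM).prod

lemma etaProd_nil : etaProd [] = 1 := rfl

lemma etaProd_append (s t : List ℤ) : etaProd (s ++ t) = etaProd s * etaProd t := by
  simp [etaProd]

lemma etaProd_singleton (a : ℤ) : etaProd [a] = etaM a := by
  simp [etaProd]

lemma etaProd_cons (a : ℤ) (s : List ℤ) : etaProd (a :: s) = etaM a * etaProd s := by
  simp [etaProd]

lemma det_etaProd (s : List ℤ) : (etaProd s).det = 1 := by
  induction s with
  | nil => simp [etaProd_nil]
  | cons a s ih => rw [etaProd_cons, det_mul, ih, etaM, det_fin_two]; simp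

lemma etaProd_cons_one_zero (a : ℤ) (s : List ℤ) : etaProd (a :: s) 1 0 = etaProd s 0 0 := by
  simp [etaProd_cons, etaM, mul_apply, Fin.sum_univ_two]

lemma etaProd_cons_zero_zero (a : ℤ) (s : List ℤ) :
    etaProd (a :: s) 0 0 = a * etaProd s 0 0 - etaProd s 1 0 := by
  simp [etaProd_cons, etaM, mul_apply, Fin.sum_univ_two]; ring

lemma etaProd_concat_zero (s : List ℤ) (a : ℤ) (i : Fin 2) :
    etaProd (s ++ [a]) i 0 = a * etaProd s i 0 + etaProd s i 1 := by
  simp [etaProd_append, etaProd_singleton, etaM, mul_apply, Fin.sum_univ_two]; ring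

lemma etaProd_concat_one (s : List ℤ) (a : ℤ) (i : Fin 2) :
    etaProd (s ++ [a]) i 1 = -etaProd s i 0 := by
  simp [etaProd_append, etaProd_singleton, etaM, mul_apply, Fin.sum_univ_two]

lemma etaProd_reverse (s : List ℤ) :
    etaProd s.reverse =
      !![etaProd s 0 0, -etaProd s 1 0; -etaProd s 0 1, etaProd s 1 1] := by
  induction s with
  | nil => ext i j; fin_cases i <;> fin_cases j <;> simp [etaProd_nil]
  | cons a s ih =>
    rw [List.reverse_cons, etaProd_append, ih, etaProd_singleton, etaProd_cons]
    ext i j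
    fin_cases i <;> fin_cases j <;>
      simp [mul_apply, Fin.sum_univ_two, etaM] <;> ring

/-- Multiplying the blow-up relation `η(a+1)η(1)η(b+1) = η(a)η(b)` on the right. -/
lemma etaProd_expand (a b : ℤ) (t : List ℤ) :
    etaProd ((a + 1) :: 1 :: (b + 1) :: t) = etaProd (a :: b :: t) := by
  simp only [etaProd_cons, ← Matrix.mul_assoc]
  congr 1
  ext i j
  fin_cases i <;> fin_cases j <;> (simp [etaM]; try ring)

lemma IsEta.etaProd_eq {c : List ℤ} (h : IsEta c) : etaProd c = -1 := by
  induction h with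
  | base => ext i j; fin_cases i <;> fin_cases j <;> simp [etaProd, etaM]
  | @rotate c _ ih =>
    cases c with
    | nil => simpa using ih
    | cons x t =>
      rw [etaProd_cons] at ih
      have h1 : (-etaM x) * etaProd t = 1 := by rw [Matrix.neg_mul, ih, neg_neg]
      have h2 := mul_eq_one_comm.mp h1
      simp only [List.rotate_cons_succ, List.rotate_zero, etaProd_append, etaProd_singleton]
      rw [← h2, Matrix.mul_neg, neg_neg]
  | @reverse c _ ih =>
    rw [etaProd_reverse, ih]
    ext i j; fin_cases i <;> fin_cases j <;> simp
  | expand _ ih => rw [etaProd_expand, ih]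

lemma IsEta.etaProd_pos {c : List ℤ} (h : IsEta c) :
    ∀ u s w : List ℤ, c = u ++ s ++ w → s ≠ [] → w ≠ [] → 0 < etaProd s 1 0 := by
  induction h with
  | base =>
    intro u s w h hs hw
    have hl := congrArg List.length h
    rcases s with _ | ⟨x, _ | ⟨y, s⟩⟩
    · simp at hs
    · simp [etaProd_cons_one_zero, etaProd_nil]
    · have := List.length_pos_iff.mpr hw
      simp at hl
      omega
  | @rotate c hc ih =>
    intro u s w h hs hw
    rcases c with _ | ⟨x, t⟩
    · simp_all
    obtain ⟨w, y, rfl⟩ := List.eq_nil_or_concat w |>.resolve_left hw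
    simp only [List.rotate_cons_succ, List.rotate_zero, ← List.append_assoc,
      List.concat_eq_append] at h
    obtain ⟨rfl, h2⟩ := List.append_inj' h rfl
    by_cases hw' : w = []
    · subst hw'
      have h3 := ih [] (x :: u) s (by simp) (by simp) hs
      have h4 := hc.etaProd_eq
      rw [List.append_nil, ← List.cons_append, etaProd_append] at h4
      have hd := det_etaProd (x :: u)
      have h00 := congrFun (congrFun h4 0) 0
      have h10 := congrFun (congrFun h4 1) 0
      simp only [mul_apply, Fin.sum_univ_two, Matrix.neg_apply, one_apply] at h00 h10
      rw [det_fin_two] at hd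
      simp only [Fin.isValue, if_true, one_ne_zero, if_false] at h00 h10
      have : etaProd s 1 0 = etaProd (x :: u) 1 0 := by
        linear_combination etaProd (x :: u) 0 0 * h10 - etaProd (x :: u) 1 0 * h00
          - etaProd s 1 0 * hd
      omega
    · exact ih (x :: u) s w (by simp) hs hw'
  | @reverse c hc ih =>
    intro u s w h hs hw
    obtain ⟨w, x, rfl⟩ : ∃ w' x, w = x :: w' := by
      cases w with
      | nil => simp at hw
      | cons x w => exact ⟨w, x, rfl⟩
    obtain ⟨s, y, rfl⟩ : ∃ s' y, s = y :: s' := by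
      cases s with
      | nil => simp at hs
      | cons x w => exact ⟨w, x, rfl⟩
    have h1 : c = w.reverse ++ (x :: s.reverse) ++ (y :: u.reverse) := by
      rw [← List.reverse_reverse c, h]; simp
    have h2 := ih _ _ _ h1 (by simp) (by simp)
    rw [etaProd_cons_one_zero, etaProd_reverse] at h2
    rw [etaProd_cons_one_zero]
    simpa [mul_apply, Fin.sum_univ_two] using h2
  | @expand a b t _ ih =>
    intro u s w h hs hw
    have htail (s : List ℤ) : t = s ++ w → 0 < etaProd s 0 0 := by
      intro ht
      have := ih [a] (b :: s) w (by simp [ht]) (by simp) hw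
      rwa [etaProd_cons_one_zero] at this
    rcases u with _ | ⟨u0, _ | ⟨u1, _ | ⟨u2, u⟩⟩⟩
    · rcases s with _ | ⟨s0, _ | ⟨s1, _ | ⟨s2, s⟩⟩⟩
      · simp at hs
      · simp [etaProd_cons_one_zero, etaProd_nil]
      · simp at h
        obtain ⟨rfl, rfl, h⟩ := h
        simp [etaProd_cons_one_zero, etaProd_cons_zero_zero, etaProd_nil]
      · simp at h
        obtain ⟨rfl, rfl, rfl, rfl⟩ := h
        rw [etaProd_expand]
        exact ih [] (a :: b :: s) w (by simp) (by simp) hw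
    · rcases s with _ | ⟨s1, _ | ⟨s2, s⟩⟩
      · simp at hs
      · simp [etaProd_cons_one_zero, etaProd_nil]
      · simp at h
        obtain ⟨rfl, rfl, rfl, h⟩ := h
        have h1 := ih [] (a :: b :: s) w (by simp [h]) (by simp) hw
        have h2 := htail s h
        rw [etaProd_cons_one_zero, etaProd_cons_zero_zero] at h1 ⊢
        linarith
    · rcases s with _ | ⟨s2, s⟩
      · simp at hs
      · simp at h
        obtain ⟨rfl, rfl, rfl, h⟩ := h
        rw [etaProd_cons_one_zero]
        exact htail s h
    · simp at h
      obtain ⟨rfl, rfl, rfl, rfl⟩ := h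
      exact ih (a :: b :: u) s w (by simp) hs hw

/-- The first column of `η(c₁)⋯η(c_{j-1})`. -/
def etaVec (c : List ℤ) (j : ℕ) (k : Fin 2) : ℤ := etaProd (c.take (j - 1)) k 0

/-- The determinant of the columns `etaVec c i` and `etaVec c j`. -/
def etaDet (c : List ℤ) (i j : ℕ) : ℤ :=
  etaVec c i 0 * etaVec c j 1 - etaVec c i 1 * etaVec c j 0

lemma phi_self (c : List ℤ) (i : ℕ) : phi c i i = 0 := by simp [phi]

lemma phi_comm (c : List ℤ) (i j : ℕ) : phi c i j = phi c j i := by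
  unfold phi
  split_ifs <;> first | rfl | omega

lemma phi_eq_etaDet (c : List ℤ) {i j : ℕ} (hi : 1 ≤ i) (hij : i < j) :
    phi c i j = etaDet c i j := by
  have h1 : c.take (j - 1) = c.take (i - 1) ++ (c.drop (i - 1)).take (j - i) := by
    rw [← List.take_add]; congr 1; omega
  have hd := det_etaProd (c.take (i - 1))
  rw [det_fin_two] at hd
  rw [phi, if_neg (by omega), if_pos hij]
  change etaProd _ 1 0 = _
  simp only [etaDet, etaVec, h1, etaProd_append, mul_apply, Fin.sum_univ_two]
  linear_combination (-etaProd ((c.drop (i - 1)).take (j - i)) 1 0) * hd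

lemma IsEta.phi_pos {c : List ℤ} (h : IsEta c) {i j : ℕ} (hi : i ∈ Icc 1 c.length)
    (hj : j ∈ Icc 1 c.length) (hij : i ≠ j) : 0 < phi c i j := by
  have key : ∀ {i j : ℕ}, i ∈ Icc 1 c.length → j ∈ Icc 1 c.length → i < j →
      0 < phi c i j := by
    intro i j hi hj hij
    simp only [mem_Icc] at hi hj
    rw [phi, if_neg (by omega), if_pos hij]
    refine h.etaProd_pos (c.take (i - 1)) _ (c.drop (j - 1)) ?_ ?_ ?_
    · rw [← List.take_add, show i - 1 + (j - i) = j - 1 by omega, List.take_append_drop]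
    · rw [← List.length_pos_iff]; simp; omega
    · rw [← List.length_pos_iff]; simp; omega
  rcases lt_or_gt_of_ne hij with h1 | h1
  · exact key hi hj h1
  · rw [phi_comm]; exact key hj hi h1

lemma etaVec_one (c : List ℤ) : etaVec c 1 0 = 1 ∧ etaVec c 1 1 = 0 := by
  simp [etaVec, etaProd_nil]

lemma take_eq_concat_entryOf (c : List ℤ) {j : ℕ} (hj : 1 ≤ j) (hj' : j ≤ c.length) :
    c.take j = c.take (j - 1) ++ [entryOf c j] := by
  obtain ⟨k, rfl⟩ : ∃ k, j = k + 1 := ⟨j - 1, by omega⟩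
  rw [List.take_succ_eq_append_getElem (by omega)]
  simp [entryOf, List.getElem?_eq_getElem (show k < c.length by omega)]

lemma etaVec_two (c : List ℤ) (h : 1 ≤ c.length) :
    etaVec c 2 0 = entryOf c 1 ∧ etaVec c 2 1 = 1 := by
  have := take_eq_concat_entryOf c le_rfl h
  simp [etaVec, this, etaProd_singleton, etaM]

lemma etaVec_add_two (c : List ℤ) {j : ℕ} (hj : 1 ≤ j) (hj' : j + 1 ≤ c.length) (k : Fin 2) :
    etaVec c (j + 2) k = entryOf c (j + 1) * etaVec c (j + 1) k - etaVec c j k := by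
  have h1 := take_eq_concat_entryOf c (show 1 ≤ j + 1 by omega) hj'
  have h2 := take_eq_concat_entryOf c hj (by omega)
  simp only [Nat.add_sub_cancel] at h1
  simp only [etaVec, show j + 2 - 1 = j + 1 by omega, Nat.add_sub_cancel, h1,
    etaProd_concat_zero]
  rw [h2, etaProd_concat_one]
  ring

lemma IsEta.etaVec_length_add_one {c : List ℤ} (h : IsEta c) :
    etaVec c (c.length + 1) 0 = -1 ∧ etaVec c (c.length + 1) 1 = 0 := by
  simp [etaVec, h.etaProd_eq]

lemma IsEta.etaVec_length {c : List ℤ} (h : IsEta c) (hc : 1 ≤ c.length) :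
    etaVec c c.length 0 = 0 ∧ etaVec c c.length 1 = 1 := by
  have h1 := take_eq_concat_entryOf c hc le_rfl
  rw [List.take_length] at h1
  have h2 := h.etaProd_eq
  rw [h1] at h2
  have e0 := etaProd_concat_one (c.take (c.length - 1)) (entryOf c c.length) 0
  have e1 := etaProd_concat_one (c.take (c.length - 1)) (entryOf c c.length) 1
  rw [h2] at e0 e1
  simp at e0 e1
  exact ⟨by simpa [etaVec] using e0, by simp [etaVec]; omega⟩

lemma etaDet_succ (c : List ℤ) {j : ℕ} (hj : 1 ≤ j) (hj' : j ≤ c.length) :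
    etaDet c j (j + 1) = 1 := by
  have h1 := take_eq_concat_entryOf c hj hj'
  have hd := det_etaProd (c.take (j - 1))
  rw [det_fin_two] at hd
  simp only [etaDet, etaVec, Nat.add_sub_cancel, h1, etaProd_concat_zero]
  linear_combination hd

lemma addIdx_mem {n j : ℕ} (hj : j ∈ Icc 1 n) : addIdx n j 1 ∈ Icc 1 n := by
  simp only [mem_Icc, addIdx] at *
  split_ifs <;> omega

lemma exists_addIdx_eq {n j : ℕ} (hj : j ∈ Icc 1 n) : ∃ k ∈ Icc 1 n, addIdx n k 1 = j := by
  simp only [mem_Icc] at hj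
  by_cases g : j = 1
  · exact ⟨n, by simp; omega, by simp [addIdx, g]⟩
  · refine ⟨j - 1, by simp; omega, ?_⟩
    simp only [addIdx]; split_ifs <;> omega

lemma IsEta.phi_succ {c : List ℤ} (h : IsEta c) (hn : 2 ≤ c.length) {j : ℕ}
    (hj : j ∈ Icc 1 c.length) : phi c j (addIdx c.length j 1) = 1 := by
  simp only [mem_Icc] at hj
  unfold addIdx
  split_ifs with h1
  · rw [phi_eq_etaDet c hj.1 (by omega), etaDet_succ c hj.1 (by omega)]
  · obtain rfl : j = c.length := by omega
    rw [Nat.add_sub_cancel_left, phi_comm, phi_eq_etaDet c le_rfl (by omega)]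
    simp [etaDet, etaVec_one]
    exact (h.etaVec_length (by omega)).2

/-- The three-term relation `φ_i(j-1) + φ_i(j+1) = c_j φ_i(j)`, cyclically. -/
lemma IsEta.phi_add_phi {c : List ℤ} (h : IsEta c) (hn : 3 ≤ c.length) {i j : ℕ}
    (hi : i ∈ Icc 1 c.length) (hj : j ∈ Icc 1 c.length) (hij : i ≠ addIdx c.length j 1) :
    phi c i j + phi c i (addIdx c.length (addIdx c.length j 1) 1) =
      entryOf c (addIdx c.length j 1) * phi c i (addIdx c.length j 1) := by
  simp only [mem_Icc] at hi hj
  have hphi : ∀ k, 1 ≤ k → phi c i k = if i ≤ k then etaDet c i k else -etaDet c i k := by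
    intro k hk
    rcases lt_trichotomy i k with h1 | rfl | h1
    · rw [if_pos h1.le, phi_eq_etaDet c hi.1 h1]
    · rw [if_pos le_rfl, phi_self, etaDet]; ring
    · rw [if_neg (by omega), phi_comm, phi_eq_etaDet c hk h1]; simp only [etaDet]; ring
  have hz : etaDet c i i = 0 := by unfold etaDet; ring
  obtain ⟨a1, a2⟩ := etaVec_one c
  obtain ⟨b1, b2⟩ := etaVec_two c (by omega)
  obtain ⟨l1, l2⟩ := h.etaVec_length (by omega)
  obtain ⟨m1, m2⟩ := h.etaVec_length_add_one
  rcases lt_trichotomy (j + 1) c.length with h1 | h1 | h1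
  · have e1 : addIdx c.length j 1 = j + 1 := by simp [addIdx]; omega
    have e2 : addIdx c.length (j + 1) 1 = j + 2 := by simp [addIdx]; omega
    rw [e1] at hij
    rw [e1, e2, hphi _ hj.1, hphi _ (by omega), hphi _ (by omega)]
    have r := etaVec_add_two c hj.1 (by omega)
    have : etaDet c i j + etaDet c i (j + 2) = entryOf c (j + 1) * etaDet c i (j + 1) := by
      simp only [etaDet, r]; ring
    by_cases g : i ≤ j
    · simpa [g, show i ≤ j + 2 by omega, show i ≤ j + 1 by omega] using this
    by_cases g' : i = j + 2
    · subst g'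
      rw [hz] at this ⊢
      simp
      linarith
    · simp [g, show ¬ i ≤ j + 2 by omega, show ¬ i ≤ j + 1 by omega]
      linarith
  · have e1 : addIdx c.length j 1 = j + 1 := by simp [addIdx]; omega
    have e2 : addIdx c.length (j + 1) 1 = 1 := by simp [addIdx, h1]
    rw [e1] at hij
    rw [e1, e2, hphi _ hj.1, hphi _ (by omega), hphi _ (by omega)]
    have r := etaVec_add_two c hj.1 (by omega)
    rw [show j + 2 = c.length + 1 by omega] at r
    have r0 := r 0
    have r1 := r 1
    have : etaDet c i j - etaDet c i 1 = entryOf c (j + 1) * etaDet c i (j + 1) := by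
      simp only [etaDet]
      linear_combination etaVec c i 0 * (r1 - m2 - a2) - etaVec c i 1 * (r0 - m1 - a1)
    have g : i ≤ j := by omega
    by_cases g' : i = 1
    · subst g'
      rw [hz] at this ⊢
      simp [g]
      linarith
    · simp [g, show ¬ i ≤ 1 by omega, show i ≤ j + 1 by omega]
      linarith
  · obtain rfl : j = c.length := by omega
    have e1 : addIdx c.length c.length 1 = 1 := by simp [addIdx]
    have e2 : addIdx c.length 1 1 = 2 := by simp [addIdx]; omega
    rw [e1] at hij
    rw [e1, e2, hphi _ hj.1, hphi _ (by omega), hphi _ (by omega)]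
    have : -etaDet c i c.length + etaDet c i 2 = entryOf c 1 * etaDet c i 1 := by
      simp only [etaDet, a1, a2, b1, b2, l1, l2]
      ring
    by_cases g' : i = 2
    · subst g'
      rw [hz] at this ⊢
      simp [show 2 ≤ c.length by omega]
      linarith
    · simp [hi.2, show ¬ i ≤ 2 by omega, show ¬ i ≤ 1 by omega]
      linarith

/-- The indices `a, b, c, d` are in cyclic order. -/
def CyclicOrd (a b c d : ℕ) : Prop :=
  (a < b ∧ b < c ∧ c < d) ∨ (b < c ∧ c < d ∧ d < a) ∨
    (c < d ∧ d < a ∧ a < b) ∨ (d < a ∧ a < b ∧ b < c)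

lemma phi_ptolemy (s : List ℤ) {a b c d : ℕ} (ha : 1 ≤ a) (hb : 1 ≤ b) (hc : 1 ≤ c)
    (hd : 1 ≤ d) (h : CyclicOrd a b c d) :
    phi s a c * phi s b d = phi s a b * phi s c d + phi s a d * phi s b c := by
  have key : ∀ {a b c d : ℕ}, 1 ≤ a → a < b → b < c → c < d →
      phi s a c * phi s b d = phi s a b * phi s c d + phi s a d * phi s b c := by
    intro a b c d h1 h2 h3 h4
    rw [phi_eq_etaDet s h1 h2, phi_eq_etaDet s h1 (h2.trans h3),
      phi_eq_etaDet s h1 (h2.trans (h3.trans h4)), phi_eq_etaDet s (by omega) h3,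
      phi_eq_etaDet s (by omega) (h3.trans h4), phi_eq_etaDet s (by omega) h4]
    simp only [etaDet]
    ring
  rcases h with ⟨h1, h2, h3⟩ | ⟨h1, h2, h3⟩ | ⟨h1, h2, h3⟩ | ⟨h1, h2, h3⟩
  · exact key ha h1 h2 h3
  · have := key hb h1 h2 h3
    rw [phi_comm s d a, phi_comm s b a, phi_comm s c a] at this
    linarith
  · have := key hc h1 h2 h3
    rw [phi_comm s c a, phi_comm s d b, phi_comm s c b, phi_comm s d a] at this
    linarith
  · have := key hd h1 h2 h3
    rw [phi_comm s d b, phi_comm s d a, phi_comm s d c] at this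
    linarith

lemma mem_mset {c : List ℤ} {i j : ℕ} :
    j ∈ mset c i ↔ j ∈ Icc 1 c.length ∧ ∀ l ∈ Icc 1 c.length, phi c i l ≤ phi c i j := by
  simp [mset]

lemma IsEta.ne_of_mem_mset {c : List ℤ} (h : IsEta c) (hn : 2 ≤ c.length) {i j : ℕ}
    (hi : i ∈ Icc 1 c.length) (hj : j ∈ mset c i) : j ≠ i := by
  rintro rfl
  have h1 := (mem_mset.mp hj).2 _ (addIdx_mem hi)
  rw [h.phi_succ hn hi, phi_self] at h1
  omega

/-- Farthest points cannot be nested against the cyclic order. -/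
lemma IsEta.not_cyclicOrd {c : List ℤ} (h : IsEta c) {i k j l : ℕ}
    (hi : i ∈ Icc 1 c.length) (hk : k ∈ Icc 1 c.length) (hl : l ∈ mset c i)
    (hj : j ∈ mset c k) : ¬ CyclicOrd i k j l := by
  intro ho
  obtain ⟨hl1, hl2⟩ := mem_mset.mp hl
  obtain ⟨hj1, hj2⟩ := mem_mset.mp hj
  have hp := phi_ptolemy c (mem_Icc.mp hi).1 (mem_Icc.mp hk).1 (mem_Icc.mp hj1).1
    (mem_Icc.mp hl1).1 ho
  have h1 : 0 < phi c i k := h.phi_pos hi hk (by unfold CyclicOrd at ho; omega)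
  have h2 : 0 < phi c j l := h.phi_pos hj1 hl1 (by unfold CyclicOrd at ho; omega)
  have h3 : 0 < phi c i j := h.phi_pos hi hj1 (by unfold CyclicOrd at ho; omega)
  have h4 : 0 < phi c k l := h.phi_pos hk hl1 (by unfold CyclicOrd at ho; omega)
  have h5 := mul_le_mul (hl2 j hj1) (hj2 l hl1) h4.le (h3.le.trans (hl2 j hj1))
  have h6 := mul_pos h1 h2
  linarith

/-- If the maximum of `φ_i` exceeds `1`, it is not attained at two adjacent positions. -/
lemma IsEta.phi_succ_ne {c : List ℤ} (h : IsEta c) (hn : 2 ≤ c.length) {i j : ℕ}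
    (hi : i ∈ Icc 1 c.length) (hj : j ∈ Icc 1 c.length) (h2 : 2 ≤ phi c i j) :
    phi c i (addIdx c.length j 1) ≠ phi c i j := by
  intro he
  have hdvd : ∀ k ∈ Icc 1 c.length, phi c i k ∣ etaDet c i k ∧ etaDet c k i ∣ phi c i k := by
    intro k hk
    simp only [mem_Icc] at hi hk
    have hsymm : etaDet c k i = -etaDet c i k := by simp only [etaDet]; ring
    rcases lt_trichotomy i k with h1 | rfl | h1
    · rw [hsymm, phi_eq_etaDet c hi.1 h1]; simp
    · simp [phi_self, etaDet, mul_comm]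
    · rw [phi_comm, phi_eq_etaDet c hk.1 h1, hsymm]; simp
  have hs := addIdx_mem hj
  set s := addIdx c.length j 1 with hsdef
  have d1 := (hdvd j hj).1
  have d2 := (hdvd s hs).1
  rw [he] at d2
  have hjs : etaDet c j s ∣ 1 := by
    have h1 := h.phi_succ hn hj
    rw [← hsdef] at h1
    have hjs' : etaDet c j s = 1 ∨ etaDet c j s = -1 := by
      have hss : etaDet c s j = -etaDet c j s := by simp only [etaDet]; ring
      simp only [mem_Icc] at hj hs
      rcases lt_trichotomy j s with g | g | g
      · rw [phi_eq_etaDet c hj.1 g] at h1; exact Or.inl h1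
      · rw [← g, phi_self] at h1; omega
      · rw [phi_comm, phi_eq_etaDet c hs.1 g] at h1; right; omega
    rcases hjs' with g | g <;> rw [g] <;> simp
  have hv : ∀ k : Fin 2, phi c i j ∣ etaVec c i k := by
    intro k
    have e : etaVec c i k * etaDet c j s =
        etaVec c j k * etaDet c i s - etaVec c s k * etaDet c i j := by
      fin_cases k <;> (simp only [etaDet, Fin.zero_eta, Fin.mk_one]; ring)
    have e2 : phi c i j ∣ etaVec c i k * etaDet c j s := by
      rw [e]; exact dvd_sub (d2.mul_left _) (d1.mul_left _)
    exact (isUnit_of_dvd_one hjs).dvd_mul_right.mp e2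
  have hone : phi c i j ∣ 1 := by
    simp only [mem_Icc] at hi
    rw [← etaDet_succ c hi.1 hi.2, etaDet]
    exact dvd_sub ((hv 0).mul_right _) ((hv 1).mul_right _)
  have := Int.le_of_dvd one_pos hone
  omega

/-- Positions where a maximum larger than `1` is attained have entry at most `1`. -/
lemma IsEta.entryOf_le_one {c : List ℤ} (h : IsEta c) (hn : 3 ≤ c.length) {i j : ℕ}
    (hi : i ∈ Icc 1 c.length) (hj : j ∈ mset c i) (h2 : 2 ≤ phi c i j) :
    entryOf c j ≤ 1 := by
  obtain ⟨hj1, hmax⟩ := mem_mset.mp hj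
  have hne := h.ne_of_mem_mset (by omega) hi hj
  obtain ⟨k, hk, rfl⟩ : ∃ k ∈ Icc 1 c.length, addIdx c.length k 1 = j :=
      exists_addIdx_eq hj1
  have hr := h.phi_add_phi hn hi hk hne.symm
  have m1 := hmax k hk
  have m2 := hmax _ (addIdx_mem hj1)
  have m3 := lt_of_le_of_ne m2 (h.phi_succ_ne (by omega) hi hj1 h2)
  nlinarith

/-- In a sequence of length at least `4`, two adjacent entries are not both at most `1`. -/
lemma IsEta.one_lt_entryOf_succ {c : List ℤ} (h : IsEta c) (hn : 4 ≤ c.length) {j : ℕ}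
    (hj : j ∈ Icc 1 c.length) (hc : entryOf c j ≤ 1) :
    1 < entryOf c (addIdx c.length j 1) := by
  by_contra! hc'
  obtain ⟨k, hk, rfl⟩ : ∃ k ∈ Icc 1 c.length, addIdx c.length k 1 = j :=
      exists_addIdx_eq hj
  have hs := addIdx_mem hj
  have hss := addIdx_mem hs
  have n1 : k ≠ addIdx c.length k 1 := by
    simp only [addIdx, mem_Icc] at *; split_ifs <;> omega
  have n2 : k ≠ addIdx c.length (addIdx c.length k 1) 1 := by
    simp only [addIdx, mem_Icc] at *; split_ifs <;> omega
  have n3 : k ≠ addIdx c.length (addIdx c.length (addIdx c.length k 1) 1) 1 := by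
    simp only [addIdx, mem_Icc] at *; split_ifs <;> omega
  have r1 := h.phi_add_phi (by omega) hk hk n1
  have r2 := h.phi_add_phi (by omega) hk hj n2
  have p1 := h.phi_pos hk hj n1
  have p2 := h.phi_pos hk hs n2
  have p3 := h.phi_pos hk hss n3
  rw [phi_self] at r1
  nlinarith

lemma addIdx_injOn (n : ℕ) : Set.InjOn (fun j => addIdx n j 1) (Icc 1 n : Finset ℕ) := by
  intro a ha b hb hab
  simp only [coe_Icc, Set.mem_Icc, addIdx] at *
  split_ifs at hab <;> omega

/-- Entries at most `1` occupy at most half of the positions. -/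
lemma IsEta.two_mul_card_le {c : List ℤ} (h : IsEta c) (hn : 4 ≤ c.length) :
    2 * #{j ∈ Icc 1 c.length | entryOf c j ≤ 1} ≤ c.length := by
  set E := {j ∈ Icc 1 c.length | entryOf c j ≤ 1} with hE
  have hsub : (E : Set ℕ) ⊆ (Icc 1 c.length : Finset ℕ) := by
    rw [hE]; exact_mod_cast filter_subset _ _
  have h1 : #(E.image fun j => addIdx c.length j 1) = #E :=
    card_image_of_injOn ((addIdx_injOn c.length).mono hsub)
  have h2 : Disjoint E (E.image fun j => addIdx c.length j 1) := by
    rw [Finset.disjoint_left]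
    intro a ha hb
    obtain ⟨b, hb', rfl⟩ := mem_image.mp hb
    rw [hE, mem_filter] at ha hb'
    have := h.one_lt_entryOf_succ hn hb'.1 hb'.2
    omega
  have h3 : #(E ∪ E.image fun j => addIdx c.length j 1) ≤ #(Icc 1 c.length) := by
    apply card_le_card
    apply union_subset (by exact_mod_cast hsub)
    intro a ha
    obtain ⟨b, hb, rfl⟩ := mem_image.mp ha
    exact addIdx_mem (hsub hb)
  rw [card_union_of_disjoint h2, h1, Nat.card_Icc] at h3
  omega

/-- Density forces `|m_i| > 1` for at least half of the positions. -/
lemma DenseSeq.length_le {c : List ℤ} (hd : DenseSeq c) :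
    c.length ≤ 2 * #{i ∈ Icc 1 c.length | 1 < #(mset c i)} := by
  set T := {i ∈ Icc 1 c.length | 1 < #(mset c i)} with hT
  set S := {i ∈ Icc 1 c.length | 1 < #(mset c (addIdx c.length i 1))} with hS
  have h1 : Icc 1 c.length ⊆ T ∪ S := by
    intro i hi
    rw [mem_union, hT, hS, mem_filter, mem_filter]
    exact (hd i hi).imp (⟨hi, ·⟩) (⟨hi, ·⟩)
  have h2 : #S ≤ #T := by
    refine card_le_card_of_injOn (fun j => addIdx c.length j 1) ?_
      ((addIdx_injOn c.length).mono ?_)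
    · intro i hi
      rw [mem_coe, hS, mem_filter] at hi
      rw [mem_coe, hT, mem_filter]
      exact ⟨addIdx_mem hi.1, hi.2⟩
    · rw [hS]; exact_mod_cast filter_subset _ _
  have h3 := (card_le_card h1).trans (card_union_le T S)
  rw [Nat.card_Icc] at h3
  omega

/-- The number of steps from `i` to `j` going cyclically upwards. -/
def cyclicDist (n i j : ℕ) : ℕ := if i ≤ j then j - i else j + n - i

lemma exists_cyclicDist_lt {c : List ℤ} {i : ℕ} (hi : i ∈ Icc 1 c.length)
    (h : 1 < #(mset c i)) :
    ∃ j ∈ mset c i, ∃ l ∈ mset c i, cyclicDist c.length i j < cyclicDist c.length i l := by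
  obtain ⟨a, ha, b, hb, hab⟩ := one_lt_card.mp h
  have ha' := (mem_mset.mp ha).1
  have hb' := (mem_mset.mp hb).1
  have : cyclicDist c.length i a ≠ cyclicDist c.length i b := by
    simp only [mem_Icc, cyclicDist] at *
    split_ifs <;> omega
  rcases lt_or_gt_of_ne this with g | g
  · exact ⟨a, ha, b, hb, g⟩
  · exact ⟨b, hb, a, ha, g⟩

lemma cyclicDist_lt_cases {n i j l : ℕ} (hi : i ∈ Icc 1 n) (hj : j ∈ Icc 1 n)
    (hl : l ∈ Icc 1 n) (hji : j ≠ i) (h : cyclicDist n i j < cyclicDist n i l) :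
    (i < j ∧ j < l) ∨ (j < l ∧ l < i) ∨ (l < i ∧ i < j) := by
  simp only [mem_Icc, cyclicDist] at *
  split_ifs at h <;> omega

/-- A position is a non-last element of at most one of the sets `m_i`. -/
lemma IsEta.eq_of_cyclicDist_lt {c : List ℤ} (h : IsEta c) (hn : 2 ≤ c.length)
    {i i' j l l' : ℕ} (hi : i ∈ Icc 1 c.length) (hi' : i' ∈ Icc 1 c.length)
    (hj : j ∈ mset c i) (hj' : j ∈ mset c i') (hl : l ∈ mset c i) (hl' : l' ∈ mset c i')
    (hd : cyclicDist c.length i j < cyclicDist c.length i l)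
    (hd' : cyclicDist c.length i' j < cyclicDist c.length i' l') : i = i' := by
  by_contra hne
  have a1 := h.ne_of_mem_mset hn hi hj
  have a2 := h.ne_of_mem_mset hn hi' hj'
  have o1 := h.not_cyclicOrd hi hi' hl hj'
  have o2 := h.not_cyclicOrd hi' hi hl' hj
  have b1 := (mem_mset.mp hj).1
  have b2 := (mem_mset.mp hl).1
  have b3 := (mem_mset.mp hl').1
  rcases cyclicDist_lt_cases hi b1 b2 a1 hd with ⟨c1, c2⟩ | ⟨c1, c2⟩ | ⟨c1, c2⟩ <;>
  rcases cyclicDist_lt_cases hi' b1 b3 a2 hd' with ⟨d1, d2⟩ | ⟨d1, d2⟩ | ⟨d1, d2⟩ <;>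
  rcases lt_or_gt_of_ne hne with g | g <;>
  first
    | exact o1 (Or.inl ⟨by omega, by omega, by omega⟩)
    | exact o1 (Or.inr (Or.inl ⟨by omega, by omega, by omega⟩))
    | exact o1 (Or.inr (Or.inr (Or.inl ⟨by omega, by omega, by omega⟩)))
    | exact o1 (Or.inr (Or.inr (Or.inr ⟨by omega, by omega, by omega⟩)))
    | exact o2 (Or.inl ⟨by omega, by omega, by omega⟩)
    | exact o2 (Or.inr (Or.inl ⟨by omega, by omega, by omega⟩))
    | exact o2 (Or.inr (Or.inr (Or.inl ⟨by omega, by omega, by omega⟩)))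
    | exact o2 (Or.inr (Or.inr (Or.inr ⟨by omega, by omega, by omega⟩)))

/-- If the ear `e` is farthest from no point, then every `φ_i` exceeds `1` somewhere. -/
lemma IsEta.two_le_phi_of_forall_notMem {c : List ℤ} (h : IsEta c) (hn : 3 ≤ c.length) {e : ℕ}
    (he : e ∈ Icc 1 c.length) (hee : entryOf c e = 1)
    (hno : ∀ i ∈ Icc 1 c.length, e ∉ mset c i) {i j : ℕ} (hi : i ∈ Icc 1 c.length)
    (hj : j ∈ mset c i) : 2 ≤ phi c i j := by
  have large : ∀ i ∈ Icc 1 c.length, i ≠ e → ∃ k ∈ Icc 1 c.length, 2 ≤ phi c i k := by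
    intro i hi hie
    have h1 := hno i hi
    rw [mem_mset] at h1
    push Not at h1
    obtain ⟨k, hk, hk'⟩ := h1 he
    have := h.phi_pos hi he hie
    exact ⟨k, hk, by omega⟩
  suffices ∃ k ∈ Icc 1 c.length, 2 ≤ phi c i k by
    obtain ⟨k, hk, hk'⟩ := this
    exact hk'.trans ((mem_mset.mp hj).2 k hk)
  by_cases hie : i = e
  · subst hie
    have hs := addIdx_mem hi
    have hne : addIdx c.length i 1 ≠ i := by
      simp only [mem_Icc, addIdx] at *; split_ifs <;> omega
    obtain ⟨k, hk, hk'⟩ := large _ hs hne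
    have hki : k ≠ i := by
      rintro rfl
      rw [phi_comm, h.phi_succ (by omega) hi] at hk'
      omega
    obtain ⟨m, hm, rfl⟩ : ∃ k ∈ Icc 1 c.length, addIdx c.length k 1 = i :=
      exists_addIdx_eq hi
    have r := h.phi_add_phi hn hk hm hki
    rw [hee, one_mul, phi_comm c k (addIdx c.length m 1),
      phi_comm c k (addIdx c.length (addIdx c.length m 1) 1)] at r
    have : 0 ≤ phi c k m := by
      by_cases g : k = m
      · rw [g, phi_self]
      · exact (h.phi_pos hk hm g).le
    exact ⟨k, hk, by omega⟩
  · exact large i hi hie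

lemma IsEta.two_le_length {c : List ℤ} (h : IsEta c) : 2 ≤ c.length := by
  induction h with
  | base => simp
  | rotate _ ih => simpa using ih
  | reverse _ ih => simpa using ih
  | expand _ ih => simp

lemma IsEta.entryOf_eq_zero {c : List ℤ} (h : IsEta c) (hn : c.length = 2) (e : ℕ) :
    entryOf c e = 0 := by
  obtain ⟨a, b, rfl⟩ := List.length_eq_two.mp hn
  have h1 := h.etaProd_eq
  have h00 := congrFun (congrFun h1 0) 1
  have h10 := congrFun (congrFun h1 1) 0
  simp [etaProd, etaM] at h00 h10
  subst h00 h10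
  rcases e with _ | _ | _ | e <;> simp [entryOf]

theorem ear_mem_some_mset (c : List ℤ) (h : IsEta c) (hd : DenseSeq c)
    (e : ℕ) (he : e ∈ Finset.Icc 1 c.length) (hee : entryOf c e = 1) :
    ∃ i ∈ Finset.Icc 1 c.length, e ∈ mset c i := by
  by_contra! hno
  have hn2 := h.two_le_length
  have hn3 : 3 ≤ c.length := by
    by_contra! hlt
    have := h.entryOf_eq_zero (by omega) e
    omega
  have hlarge := fun {i j : ℕ} => h.two_le_phi_of_forall_notMem hn3 he hee hno (i := i) (j := j)
  have hn4 : 4 ≤ c.length := by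
    by_contra! hlt
    have h1 : (1 : ℕ) ∈ Icc 1 c.length := by simp; omega
    obtain ⟨j, hj, hj'⟩ := exists_max_image (Icc 1 c.length) (phi c 1) ⟨1, h1⟩
    have hl := hlarge h1 (mem_mset.mpr ⟨hj, hj'⟩)
    have s1 := h.phi_succ hn2 h1
    have hj3 := mem_Icc.mp hj
    have s3 := h.phi_succ hn2 (j := c.length) (by simp; omega)
    have l3 : c.length = 3 := by omega
    rw [l3, phi_comm] at s3
    rw [l3] at s1 hj3
    simp only [addIdx] at s1 s3
    norm_num at s1 s3
    obtain rfl | rfl | rfl : j = 1 ∨ j = 2 ∨ j = 3 := by omega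
    · rw [phi_self] at hl; omega
    · omega
    · omega
  set T := {i ∈ Icc 1 c.length | 1 < #(mset c i)} with hT
  set E := {j ∈ Icc 1 c.length | entryOf c j ≤ 1} with hE
  have hET : ∀ i ∈ T, ∃ j ∈ mset c i, ∃ l ∈ mset c i,
      cyclicDist c.length i j < cyclicDist c.length i l := fun i hi =>
    exists_cyclicDist_lt (mem_filter.mp hi).1 (mem_filter.mp hi).2
  choose! f hf g hg hfg using hET
  have heE : e ∈ E := mem_filter.mpr ⟨he, hee.le⟩
  have hcard : #T ≤ #(E.erase e) := by
    refine card_le_card_of_injOn f ?_ ?_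
    · intro i hi
      have hi1 := (mem_filter.mp hi).1
      rw [mem_coe, mem_erase]
      refine ⟨fun hfe => hno i hi1 (hfe ▸ hf i hi), mem_filter.mpr ⟨(mem_mset.mp (hf i hi)).1, ?_⟩⟩
      exact h.entryOf_le_one hn3 hi1 (hf i hi) (hlarge hi1 (hf i hi))
    · intro i hi k hk hik
      exact h.eq_of_cyclicDist_lt hn2 (mem_filter.mp hi).1 (mem_filter.mp hk).1 (hf i hi)
        (hik ▸ hf k hk) (hg i hi) (hg k hk) (hfg i hi) (hik ▸ hfg k hk)
  rw [card_erase_of_mem heE] at hcard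
  have hpos := card_pos.mpr ⟨e, heE⟩
  have hE2 := h.two_mul_card_le hn4
  have hT2 := hd.length_le
  rw [← hE] at hE2
  rw [← hT] at hT2
  omega
end

section
/- Let c = (c₁,…,cₙ) ∈ 𝒜⁺ be dense with n > 4. Then: (1) for every i ∈ {1,…,n} there exists an ear e of c such that m_i = {e} or m_i = {e, e⊕2}, where e⊕2 denotes e+2 reduced modulo n to a value in {1,…,n}; and (2) for every ear e of c there exists i ∈ {1,…,n} with m_i = {e, e⊕2}. -/
open Matrix Finset

namespace EtaSeq

/-- A sequence of plane vectors `(x k, y k)` with the recursion of a frieze of period `n`. -/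
structure Frieze (n : ℕ) (C x y : ℕ → ℤ) : Prop where
  recx : ∀ k, x (k + 2) = C (k + 1) * x (k + 1) - x k
  recy : ∀ k, y (k + 2) = C (k + 1) * y (k + 1) - y k
  antix : ∀ k, x (k + n) = -x k
  antiy : ∀ k, y (k + n) = -y k
  periodic : ∀ k, C (k + n) = C k
  det_succ : ∀ k, x k * y (k + 1) - y k * x (k + 1) = 1
  det_pos : ∀ i j, i < j → j < i + n → 0 < x i * y j - y i * x j

/-- Position `j` maximizes `|det (v_i, v_j)|`. -/
def MaxAt (x y : ℕ → ℤ) (i j : ℕ) : Prop :=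
  ∀ l, |x i * y l - y i * x l| ≤ |x i * y j - y i * x j|

/-- Position `j` is the first maximum strictly after `i`. -/
def FirstMax (n : ℕ) (x y : ℕ → ℤ) (i j : ℕ) : Prop :=
  i < j ∧ j < i + n ∧ MaxAt x y i j ∧ ∀ l, i < l → l < j → ¬ MaxAt x y i l

/-- The maximum for `i` is attained at least twice. -/
def Multi (n : ℕ) (x y : ℕ → ℤ) (i : ℕ) : Prop :=
  ∃ j k, i < j ∧ j < k ∧ k < i + n ∧ MaxAt x y i j ∧ MaxAt x y i k

/-- Without repetition, the maximum is attained at a single position of the window. -/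
theorem maxAt_iff_of_not_multi {n : ℕ} {x y : ℕ → ℤ} {i j : ℕ}
    (h : FirstMax n x y i j) (m : ¬ Multi n x y i) (l : ℕ) (h1 : i < l) (h2 : l < i + n) :
    MaxAt x y i l ↔ l = j := by
  refine ⟨fun ml => ?_, fun e => e ▸ h.2.2.1⟩
  rcases lt_trichotomy l j with hlt | heq | hgt
  · exact (h.2.2.2 l h1 hlt ml).elim
  · exact heq
  · exact (m ⟨j, l, h.1, hgt, h2, h.2.2.1, ml⟩).elim

theorem sum_add_shift {n : ℕ} (g : ℕ → ℕ) (hg : g n = g 0) :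
    ∑ k ∈ Finset.range n, (g k + g (k + 1)) = 2 * ∑ k ∈ Finset.range n, g k := by
  have h1 := Finset.sum_range_succ g n
  have h2 := Finset.sum_range_succ' g n
  rw [Finset.sum_add_distrib]
  omega

namespace Frieze

variable {n : ℕ} {C x y : ℕ → ℤ}

theorem maxAt_add_right (F : Frieze n C x y) (i j : ℕ) :
    MaxAt x y i (j + n) ↔ MaxAt x y i j := by
  have : |x i * y (j + n) - y i * x (j + n)| = |x i * y j - y i * x j| := by
    rw [F.antix, F.antiy, ← abs_neg]; congr 1; ring
  simp [MaxAt, this]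

theorem maxAt_add_left (F : Frieze n C x y) (i j : ℕ) :
    MaxAt x y (i + n) j ↔ MaxAt x y i j := by
  have (l : ℕ) : |x (i + n) * y l - y (i + n) * x l| = |x i * y l - y i * x l| := by
    rw [F.antix, F.antiy, ← abs_neg]; congr 1; ring
  simp [MaxAt, this]

theorem abs_det_mod (F : Frieze n C x y) (i l : ℕ) :
    |x i * y (l % n) - y i * x (l % n)| = |x i * y l - y i * x l| := by
  have key (q r : ℕ) : |x i * y (r + n * q) - y i * x (r + n * q)| =
      |x i * y r - y i * x r| := by
    induction q with
    | zero => simp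
    | succ q ih =>
      rw [← ih, mul_add, mul_one, ← add_assoc, F.antix, F.antiy, ← abs_neg]
      congr 1; ring
  conv_rhs => rw [← Nat.mod_add_div l n]
  exact (key _ _).symm

theorem maxAt_mod (F : Frieze n C x y) (i j : ℕ) :
    MaxAt x y i (j % n) ↔ MaxAt x y i j := by
  simp only [MaxAt, F.abs_det_mod]

theorem firstMax_add (F : Frieze n C x y) {i j : ℕ} (h : FirstMax n x y i j) :
    FirstMax n x y (i + n) (j + n) := by
  obtain ⟨h1, h2, h3, h4⟩ := h
  refine ⟨by omega, by omega, ?_, fun l hl hl' hm => ?_⟩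
  · rwa [F.maxAt_add_left, F.maxAt_add_right]
  · obtain ⟨m, rfl⟩ : ∃ m, l = m + n := ⟨l - n, by omega⟩
    rw [F.maxAt_add_left, F.maxAt_add_right] at hm
    exact h4 m (by omega) (by omega) hm

theorem multi_add (F : Frieze n C x y) {i : ℕ} :
    Multi n x y (i + n) ↔ Multi n x y i := by
  constructor
  · rintro ⟨j, k, h1, h2, h3, h4, h5⟩
    obtain ⟨j, rfl⟩ : ∃ m, j = m + n := ⟨j - n, by omega⟩
    obtain ⟨k, rfl⟩ : ∃ m, k = m + n := ⟨k - n, by omega⟩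
    rw [F.maxAt_add_left, F.maxAt_add_right] at h4 h5
    exact ⟨j, k, by omega, by omega, by omega, h4, h5⟩
  · rintro ⟨j, k, h1, h2, h3, h4, h5⟩
    refine ⟨j + n, k + n, by omega, by omega, by omega, ?_, ?_⟩ <;>
    rwa [F.maxAt_add_left, F.maxAt_add_right]

theorem le_of_maxAt (F : Frieze n C x y) {i j : ℕ} (h : MaxAt x y i j)
    (h1 : i < j) (h2 : j < i + n) (l : ℕ) :
    x i * y l - y i * x l ≤ x i * y j - y i * x j := by
  have := h l
  rw [abs_of_pos (F.det_pos i j h1 h2)] at this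
  exact (le_abs_self _).trans this

theorem maxAt_of_eq (F : Frieze n C x y) {i j l : ℕ} (h : MaxAt x y i j)
    (h1 : i < j) (h2 : j < i + n)
    (e : x i * y j - y i * x j ≤ x i * y l - y i * x l) : MaxAt x y i l := by
  intro k
  refine (h k).trans ?_
  rw [abs_of_pos (F.det_pos i j h1 h2)]
  exact e.trans (le_abs_self _)

theorem not_maxAt_self (F : Frieze n C x y) (i : ℕ) : ¬ MaxAt x y i i := by
  intro h
  have h1 := h (i + 1)
  rw [F.det_succ i, mul_comm (x i)] at h1
  simp at h1

theorem exists_firstMax (F : Frieze n C x y) (hn : 1 < n) (i : ℕ) :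
    ∃ j, FirstMax n x y i j := by
  classical
  obtain ⟨j, hj, hmax⟩ := (Finset.range n).exists_max_image
    (fun l => |x i * y l - y i * x l|) ⟨0, by simp; omega⟩
  have hm : MaxAt x y i j := by
    intro l
    rw [← F.abs_det_mod i l]
    exact hmax _ (by simp; exact Nat.mod_lt _ (by omega))
  have hex : ∃ k, i < k ∧ MaxAt x y i k := by
    refine ⟨j + n * (i + 1), by nlinarith, ?_⟩
    rw [← F.maxAt_mod, Nat.add_mul_mod_self_left, F.maxAt_mod]
    exact hm
  refine ⟨Nat.find hex, (Nat.find_spec hex).1, ?_, (Nat.find_spec hex).2,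
    fun l hl hl' hm' => Nat.find_min hex hl' ⟨hl, hm'⟩⟩
  by_contra hlt
  push Not at hlt
  obtain ⟨k, hk⟩ : ∃ k, Nat.find hex = k + n := ⟨Nat.find hex - n, by omega⟩
  have hk' := (Nat.find_spec hex).2
  rw [hk, F.maxAt_add_right] at hk'
  rcases eq_or_ne k i with rfl | hki
  · exact F.not_maxAt_self _ hk'
  · exact Nat.find_min hex (m := k) (by omega) ⟨by omega, hk'⟩

theorem firstMax_injective (F : Frieze n C x y) {i i' j : ℕ} (h : FirstMax n x y i j)
    (h' : FirstMax n x y i' j) (m : Multi n x y i) : ¬ i < i' := by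
  intro hlt
  obtain ⟨k, hk1, hk2, hk3⟩ : ∃ k, j < k ∧ k < i + n ∧ MaxAt x y i k := by
    obtain ⟨a, b, h1, h2, h3, h4, h5⟩ := m
    refine ⟨b, ?_, h3, h5⟩
    by_contra hb
    exact h.2.2.2 a h1 (by omega) h4
  have e1 := F.le_of_maxAt h.2.2.1 h.1 h.2.1 k
  have e2 := F.le_of_maxAt hk3 (h.1.trans hk1) hk2 j
  have e3 := F.le_of_maxAt h'.2.2.1 h'.1 h'.2.1 k
  have p1 := F.det_pos i i' hlt (by have := h'.1; have := h.2.1; omega)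
  have p2 := F.det_pos j k hk1 (by have := h.1; omega)
  have p3 := F.det_pos i j h.1 h.2.1
  -- Plücker relation for `i, i', j, k`
  have pl : (x i * y j - y i * x j) * (x i' * y k - y i' * x k) =
      (x i * y i' - y i * x i') * (x j * y k - y j * x k) +
      (x i * y k - y i * x k) * (x i' * y j - y i' * x j) := by ring
  have e4 : x i * y k - y i * x k = x i * y j - y i * x j := le_antisymm e1 e2
  rw [e4] at pl
  nlinarith [mul_pos p1 p2]

theorem ear_pos (F : Frieze n C x y) (hn : 2 < n) (k : ℕ) : 0 < C k := by
  have h := F.det_pos (k + n - 1) (k + n + 1) (by omega) (by omega)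
  obtain ⟨m, hm⟩ : ∃ m, k + n = m + 1 := ⟨k + n - 1, by omega⟩
  have hC : C (m + 1) = C k := by rw [← hm, F.periodic]
  rw [hm] at h
  have hd := F.det_succ m
  simp only [Nat.add_sub_cancel] at h
  rw [show m + 1 + 1 = m + 2 from rfl, F.recx, F.recy, hC] at h
  nlinarith

theorem not_adjacent_ears (F : Frieze n C x y) (hn : 3 < n) (k : ℕ)
    (h1 : C k = 1) (h2 : C (k + 1) = 1) : False := by
  obtain ⟨m, hm⟩ : ∃ m, k + n = m + 1 := ⟨k + n - 1, by omega⟩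
  have h := F.det_pos m (m + 3) (by omega) (by omega)
  rw [← F.periodic, hm] at h1
  rw [← F.periodic, show k + 1 + n = m + 2 by omega] at h2
  have e1 := F.recx m
  have e2 := F.recy m
  have e3 := F.recx (m + 1)
  have e4 := F.recy (m + 1)
  simp only [add_assoc, Nat.reduceAdd] at e1 e2 e3 e4
  rw [e3, e4, h2, e1, e2, h1] at h
  nlinarith

theorem not_one_two_one (F : Frieze n C x y) (hn : 4 < n) (k : ℕ)
    (h1 : C k = 1) (h2 : C (k + 1) = 2) (h3 : C (k + 2) = 1) : False := by
  obtain ⟨m, hm⟩ : ∃ m, k + n = m + 1 := ⟨k + n - 1, by omega⟩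
  have h := F.det_pos m (m + 4) (by omega) (by omega)
  rw [← F.periodic, hm] at h1
  rw [← F.periodic, show k + 1 + n = m + 2 by omega] at h2
  rw [← F.periodic, show k + 2 + n = m + 3 by omega] at h3
  have e1 := F.recx m
  have e2 := F.recy m
  have e3 := F.recx (m + 1)
  have e4 := F.recy (m + 1)
  have e5 := F.recx (m + 2)
  have e6 := F.recy (m + 2)
  simp only [add_assoc, Nat.reduceAdd] at e1 e2 e3 e4 e5 e6
  rw [e5, e6, h3, e3, e4, h2, e1, e2, h1] at h
  nlinarith

theorem det_add_det (F : Frieze n C x y) (i k : ℕ) :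
    (x i * y k - y i * x k) + (x i * y (k + 2) - y i * x (k + 2)) =
      C (k + 1) * (x i * y (k + 1) - y i * x (k + 1)) := by
  rw [F.recx, F.recy]; ring

theorem ear_of_firstMax (F : Frieze n C x y) (hn : 2 < n) {i j : ℕ}
    (h : FirstMax n x y i j) : C j = 1 := by
  obtain ⟨h1, h2, h3, h4⟩ := h
  obtain ⟨k, rfl⟩ : ∃ k, j = k + 1 := ⟨j - 1, by omega⟩
  have hle := F.le_of_maxAt h3 h1 h2
  have hpos := F.det_pos i (k + 1) h1 h2
  have hlt : x i * y k - y i * x k < x i * y (k + 1) - y i * x (k + 1) := by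
    by_contra hge
    have := F.maxAt_of_eq h3 h1 h2 (not_lt.1 hge)
    rcases eq_or_ne k i with rfl | hki
    · exact F.not_maxAt_self _ this
    · exact h4 k (by omega) (by omega) this
  have hs := F.det_add_det i k
  have := hle (k + 2)
  have hc : C (k + 1) < 2 := by nlinarith
  have := F.ear_pos hn (k + 1)
  omega

/-- No strict vertex of the hull lies between two points of an edge. -/
theorem not_firstMax_between (F : Frieze n C x y) {i j k l i' : ℕ} (hij : i < j) (hjl : j < l)
    (hlk : l < k) (hk : k < i + n) (mj : MaxAt x y i j) (mk : MaxAt x y i k)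
    (h : FirstMax n x y i' l) : False := by
  obtain ⟨h1, h2, h3, h4⟩ := h
  have A := F.det_pos l k hlk (by omega)
  have B := F.det_pos j l hjl (by omega)
  have T := F.det_pos j k (by omega) (by omega)
  have P := F.det_pos i j hij (by omega)
  have P' := F.det_pos i' l h1 h2
  have e : x i * y j - y i * x j = x i * y k - y i * x k :=
    le_antisymm (F.le_of_maxAt mk (by omega) hk j) (F.le_of_maxAt mj hij (by omega) k)
  have el := F.le_of_maxAt mj hij (by omega) l
  have fj := F.le_of_maxAt h3 h1 h2 j
  have fk := F.le_of_maxAt h3 h1 h2 k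
  have pl (s : ℕ) : (x j * y k - y j * x k) * (x s * y l - y s * x l) =
      (x l * y k - y l * x k) * (x s * y j - y s * x j) +
      (x j * y l - y j * x l) * (x s * y k - y s * x k) := by ring
  have p1 := pl i
  have p2 := pl i'
  rw [← e] at p1
  generalize x j * y k - y j * x k = t at *
  generalize x l * y k - y l * x k = a at *
  generalize x j * y l - y j * x l = b at *
  generalize x i * y j - y i * x j = m at *
  have hab : a + b ≤ t := by
    by_contra hc
    push Not at hc
    nlinarith
  have hm : x i' * y l - y i' * x l ≤ x i' * y j - y i' * x j := by
    by_contra hc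
    push Not at hc
    nlinarith
  have mj' := F.maxAt_of_eq h3 h1 h2 hm
  rcases lt_trichotomy j i' with hj | rfl | hj
  · have := F.det_pos j i' hj (by omega)
    linarith
  · exact F.not_maxAt_self _ mj'
  · exact h4 j hj hjl mj'

open Classical in
theorem dense_structure (F : Frieze n C x y) (hn : 4 < n)
    (hd : ∀ i < n, Multi n x y i ∨ Multi n x y (i + 1)) :
    (∀ e, C e = 1 → C (e + 2) = 1) ∧
    (∀ e < n, C e = 1 → ∃ i < n, Multi n x y i ∧
      (FirstMax n x y i e ∨ FirstMax n x y i (e + n))) := by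
  choose f hf using F.exists_firstMax (by omega : 1 < n)
  set S := (Finset.range n).filter (fun i => Multi n x y i) with hS
  set E := (Finset.range n).filter (fun i => C i = 1) with hE
  have hCmod (k : ℕ) : C (k % n) = C k := by
    have (q r : ℕ) : C (r + n * q) = C r := by
      induction q with
      | zero => simp
      | succ q ih => rw [← ih, mul_add, mul_one, ← add_assoc, F.periodic]
    conv_rhs => rw [← Nat.mod_add_div k n]
    exact (this _ _).symm
  have hmaps : ∀ i ∈ S, f i % n ∈ E := by
    intro i _
    simp only [hE, Finset.mem_filter, Finset.mem_range]
    exact ⟨Nat.mod_lt _ (by omega), by rw [hCmod]; exact F.ear_of_firstMax (by omega) (hf i)⟩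
  have hmodcases (i : ℕ) (hi : i < n) : f i = f i % n ∨ f i = f i % n + n := by
    have := (hf i).2.1
    rcases lt_or_ge (f i) n with h | h
    · left; rw [Nat.mod_eq_of_lt h]
    · right; rw [Nat.mod_eq_sub_mod h, Nat.mod_eq_of_lt (by omega)]; omega
  have hinj : Set.InjOn (fun i => f i % n) (S : Set ℕ) := by
    intro i hi i' hi' heq
    simp only [hS, Finset.coe_filter, Finset.mem_range, Set.mem_ofPred_eq] at hi hi'
    simp only at heq
    have key {a b : ℕ} (ha : FirstMax n x y a (f i)) (hb : FirstMax n x y b (f i))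
        (ma : Multi n x y a) (mb : Multi n x y b) : a = b :=
      le_antisymm (not_lt.1 (F.firstMax_injective hb ha mb))
        (not_lt.1 (F.firstMax_injective ha hb ma))
    have q := hf i
    have q' := hf i'
    rcases hmodcases i hi.1 with h | h <;> rcases hmodcases i' hi'.1 with h' | h'
    · rw [show f i' = f i by omega] at q'
      exact key q q' hi.2 hi'.2
    · have := F.firstMax_add q
      rw [show f i + n = f i' by omega] at this
      have h1 := F.firstMax_injective this q' (F.multi_add.2 hi.2)
      have h2 := F.firstMax_injective q' this hi'.2
      omega
    · have := F.firstMax_add q'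
      rw [show f i' + n = f i by omega] at this
      have := key q this hi.2 (F.multi_add.2 hi'.2)
      omega
    · rw [show f i' = f i by omega] at q'
      exact key q q' hi.2 hi'.2
  have hSE : S.card ≤ E.card := Finset.card_le_card_of_injOn _ hmaps hinj
  have hScard : n ≤ 2 * S.card := by
    have h := sum_add_shift (n := n) (fun k => if Multi n x y k then 1 else 0)
      (by have := F.multi_add (i := 0); rw [zero_add] at this; simp [this])
    rw [Finset.card_filter, ← h]
    calc n = ∑ k ∈ Finset.range n, 1 := by simp
      _ ≤ _ := Finset.sum_le_sum fun k hk => by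
        rcases hd k (Finset.mem_range.1 hk) with h | h <;> simp [h]
  have hle1 (k : ℕ) : (if C k = 1 then 1 else 0) + (if C (k + 1) = 1 then 1 else 0) ≤ 1 := by
    split_ifs with h1 h2
    · exact (F.not_adjacent_ears (by omega) k h1 h2).elim
    all_goals simp
  have hEsum := sum_add_shift (n := n) (fun k => if C k = 1 then 1 else 0)
      (by have := F.periodic 0; rw [zero_add] at this; simp [this])
  rw [← Finset.card_filter, ← hE] at hEsum
  have hEcard : 2 * E.card ≤ n := by
    rw [← hEsum]
    calc _ ≤ ∑ k ∈ Finset.range n, 1 := Finset.sum_le_sum fun k _ => hle1 k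
      _ = n := by simp
  have hone : ∀ k ∈ Finset.range n,
      (if C k = 1 then 1 else 0) + (if C (k + 1) = 1 then 1 else 0) = 1 := by
    rw [← Finset.sum_eq_sum_iff_of_le fun k _ => hle1 k, hEsum]
    simp only [Finset.sum_const, Finset.card_range, smul_eq_mul, mul_one]
    omega
  have halt (k : ℕ) (hk : C k ≠ 1) : C (k + 1) = 1 := by
    have h := hone (k % n) (Finset.mem_range.2 (Nat.mod_lt _ (by omega)))
    rw [hCmod, if_neg hk, ← hCmod (k % n + 1), Nat.mod_add_mod, hCmod] at h
    by_contra hc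
    simp [hc] at h
  refine ⟨fun e he => halt (e + 1) fun h => F.not_adjacent_ears (by omega) e he h,
    fun e hen he => ?_⟩
  obtain ⟨i, hi, hie⟩ := Finset.surjOn_of_injOn_of_card_le _ hmaps hinj (by omega)
    (show e ∈ (E : Set ℕ) by simp [hE, hen, he])
  simp only [hS, Finset.coe_filter, Finset.mem_range, Set.mem_ofPred_eq] at hi
  simp only at hie
  refine ⟨i, hi.1, hi.2, ?_⟩
  have q := hf i
  rcases hmodcases i hi.1 with h | h <;> rw [h, hie] at q
  · exact Or.inl q
  · exact Or.inr q

/-- In the dense case, a multiple maximum consists of two ears at distance two. -/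
theorem maxAt_iff_of_multi (F : Frieze n C x y) (hn : 4 < n)
    (hd : ∀ i < n, Multi n x y i ∨ Multi n x y (i + 1)) {i j : ℕ} (hi : i < n)
    (h : FirstMax n x y i j) (m : Multi n x y i) :
    j + 2 < i + n ∧ ∀ l, i < l → l < i + n → (MaxAt x y i l ↔ l = j ∨ l = j + 2) := by
  obtain ⟨hE, hV⟩ := F.dense_structure hn hd
  have hj1 := F.ear_of_firstMax (by omega) h
  have hj2 := hE j hj1
  have strict (e : ℕ) (he : C e = 1) (he' : e < 2 * n) :
      ∃ i', FirstMax n x y i' e ∨ FirstMax n x y i' (e + n) := by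
    rcases lt_or_ge e n with hlt | hge
    · obtain ⟨i', -, -, h'⟩ := hV e hlt he
      exact ⟨i', h'⟩
    · obtain ⟨m, rfl⟩ : ∃ m, e = m + n := ⟨e - n, by omega⟩
      rw [F.periodic] at he
      obtain ⟨i', -, -, h' | h'⟩ := hV m (by omega) he
      · exact ⟨i' + n, Or.inl (F.firstMax_add h')⟩
      · exact ⟨i', Or.inl h'⟩
  have hij := h.1
  have hjn := h.2.1
  have mj := h.2.2.1
  have key (k : ℕ) (hjk : j < k) (hk : k < i + n) (mk : MaxAt x y i k) : k = j + 2 := by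
    rcases lt_trichotomy k (j + 2) with hlt | heq | hgt
    · obtain rfl : k = j + 1 := by omega
      have e : x i * y j - y i * x j = x i * y (j + 1) - y i * x (j + 1) :=
        le_antisymm (F.le_of_maxAt mk (by omega) hk j) (F.le_of_maxAt mj hij hjn (j + 1))
      have le := F.le_of_maxAt mj hij hjn (j + 2)
      have hs := F.det_add_det i j
      have pos := F.det_pos i j hij hjn
      have c1 : C (j + 1) ≠ 1 := fun hc => F.not_adjacent_ears (by omega) j hj1 hc
      have c2 : C (j + 1) ≠ 2 := fun hc => F.not_one_two_one hn j hj1 hc hj2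
      have c0 := F.ear_pos (by omega) (j + 1)
      have c3 : 3 ≤ C (j + 1) := by omega
      rw [← e] at hs
      nlinarith
    · exact heq
    · obtain ⟨i', h' | h'⟩ := strict (j + 2) hj2 (by omega)
      · exact (F.not_firstMax_between hij (by omega) hgt hk mj mk h').elim
      · refine (F.not_firstMax_between (i := i + n) (j := j + n) (k := k + n)
          (by omega) (by omega) (by omega) (by omega) ?_ ?_ h').elim <;>
        rwa [F.maxAt_add_left, F.maxAt_add_right]
  have h3 : j + 2 < i + n ∧ MaxAt x y i (j + 2) := by
    obtain ⟨a, b, ha, hab, hb, ma, mb⟩ := m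
    have hja : j ≤ a := not_lt.1 fun hlt => h.2.2.2 a ha hlt ma
    rw [← key b (by omega) hb mb]
    exact ⟨hb, mb⟩
  refine ⟨h3.1, fun l h1 h2 => ⟨fun ml => ?_, ?_⟩⟩
  · rcases lt_trichotomy l j with hlt | heq | hgt
    · exact (h.2.2.2 l h1 hlt ml).elim
    · exact Or.inl heq
    · exact Or.inr (key l hgt h2 ml)
  · rintro (rfl | rfl)
    · exact mj
    · exact h3.2

end Frieze

/-- The product of the matrices `η` of the first `k` entries of the periodic extension of `c`. -/
def prefixMat (c : List ℤ) : ℕ → Matrix (Fin 2) (Fin 2) ℤ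
  | 0 => 1
  | k + 1 => prefixMat c k * etaM (c.getD (k % c.length) 0)

theorem prefixMat_eq_take (c : List ℤ) {k : ℕ} (hk : k ≤ c.length) :
    prefixMat c k = ((c.take k).map etaM).prod := by
  induction k with
  | zero => simp [prefixMat]
  | succ k ih =>
    rw [prefixMat, ih (by omega), Nat.mod_eq_of_lt (by omega), List.take_add_one,
      List.map_append, List.prod_append, List.getElem?_eq_getElem (by omega),
      List.getD_eq_getElem _ _ (by omega)]
    simp

/-- The first column of `prefixMat`, upper entry. -/
def colX (c : List ℤ) (k : ℕ) : ℤ := prefixMat c k 0 0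

/-- The first column of `prefixMat`, lower entry. -/
def colY (c : List ℤ) (k : ℕ) : ℤ := prefixMat c k 1 0

theorem prefixMat_succ (c : List ℤ) (k : ℕ) :
    prefixMat c (k + 1) = !![colX c (k + 1), -colX c k; colY c (k + 1), -colY c k] := by
  ext i j
  fin_cases i <;> fin_cases j <;>
    simp [colX, colY, prefixMat, etaM, Matrix.mul_apply, Fin.sum_univ_two]

theorem det_prefixMat (c : List ℤ) (k : ℕ) : (prefixMat c k).det = 1 := by
  induction k with
  | zero => simp [prefixMat]
  | succ k ih => rw [prefixMat, Matrix.det_mul, ih]; simp [etaM, Matrix.det_fin_two]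

theorem colX_rec (c : List ℤ) (k : ℕ) :
    colX c (k + 2) = c.getD ((k + 1) % c.length) 0 * colX c (k + 1) - colX c k := by
  rw [colX, prefixMat, prefixMat_succ]
  simp [etaM, Matrix.mul_apply, Fin.sum_univ_two]
  ring

theorem colY_rec (c : List ℤ) (k : ℕ) :
    colY c (k + 2) = c.getD ((k + 1) % c.length) 0 * colY c (k + 1) - colY c k := by
  rw [colY, prefixMat, prefixMat_succ]
  simp [etaM, Matrix.mul_apply, Fin.sum_univ_two]
  ring

theorem colXY_det_succ (c : List ℤ) (k : ℕ) :
    colX c k * colY c (k + 1) - colY c k * colX c (k + 1) = 1 := by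
  have h := det_prefixMat c (k + 1)
  rw [prefixMat_succ, Matrix.det_fin_two] at h
  simp at h
  linarith

/-- The condition on `c` from which all positivity follows. -/
structure Good (c : List ℤ) : Prop where
  two_le : 2 ≤ c.length
  prod_eq : (c.map etaM).prod = -1
  pos : ∀ k, 0 < k → k < c.length → 0 < ((c.take k).map etaM).prod 1 0

theorem Good.prefixMat_add {c : List ℤ} (h : Good c) (k : ℕ) :
    prefixMat c (k + c.length) = -prefixMat c k := by
  induction k with
  | zero => rw [zero_add, prefixMat_eq_take _ le_rfl, List.take_length, h.prod_eq, prefixMat]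
  | succ k ih =>
    rw [show k + 1 + c.length = (k + c.length) + 1 by omega, prefixMat, ih, prefixMat,
      Nat.add_mod_right, neg_mul]

theorem Good.det_pos_of_lt {c : List ℤ} (h : Good c) (i j : ℕ) (hij : i < j)
    (hj : j < c.length) : 0 < colX c i * colY c j - colY c i * colX c j := by
  have hy (k : ℕ) (h0 : 0 < k) (hk : k < c.length) : 0 < colY c k := by
    rw [colY, prefixMat_eq_take c hk.le]; exact h.pos k h0 hk
  have hy0 (k : ℕ) (hk : k < c.length) : 0 ≤ colY c k := by
    rcases Nat.eq_zero_or_pos k with rfl | h0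
    · simp [colY, prefixMat]
    · exact (hy k h0 hk).le
  obtain ⟨d, rfl⟩ : ∃ d, j = i + 1 + d := ⟨j - i - 1, by omega⟩
  clear hij
  induction d with
  | zero => rw [add_zero, colXY_det_succ]; simp
  | succ d ih =>
    have ih := ih (by omega)
    have hs := colXY_det_succ c (i + 1 + d)
    have y1 := hy (i + 1 + d) (by omega) (by omega)
    have y2 := hy (i + 1 + (d + 1)) (by omega) hj
    have y3 := hy0 i (by omega)
    rw [← add_assoc] at *
    have pl : (colX c i * colY c (i + 1 + d + 1) - colY c i * colX c (i + 1 + d + 1)) *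
        colY c (i + 1 + d) = colY c (i + 1 + d + 1) *
        (colX c i * colY c (i + 1 + d) - colY c i * colX c (i + 1 + d)) + colY c i := by
      linear_combination colY c i * hs
    have : 0 < (colX c i * colY c (i + 1 + d + 1) - colY c i * colX c (i + 1 + d + 1)) *
        colY c (i + 1 + d) := by
      rw [pl]; have := mul_pos y2 ih; linarith
    exact pos_of_mul_pos_left this y1.le

theorem Good.frieze {c : List ℤ} (h : Good c) :
    Frieze c.length (fun k => c.getD (k % c.length) 0) (colX c) (colY c) where
  recx := colX_rec c
  recy := colY_rec c
  antix k := by simp [colX, h.prefixMat_add]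
  antiy k := by simp [colY, h.prefixMat_add]
  periodic k := by simp
  det_succ := colXY_det_succ c
  det_pos i j := by
    have ax k : colX c (k + c.length) = -colX c k := by simp [colX, h.prefixMat_add]
    have ay k : colY c (k + c.length) = -colY c k := by simp [colY, h.prefixMat_add]
    induction i using Nat.strong_induction_on generalizing j with
    | _ i ih =>
      intro hij hj
      have := h.two_le
      rcases lt_or_ge i c.length with hi | hi
      · rcases lt_or_ge j c.length with hjn | hjn
        · exact h.det_pos_of_lt i j hij hjn
        · obtain ⟨m, rfl⟩ : ∃ m, j = m + c.length := ⟨j - c.length, by omega⟩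
          have := h.det_pos_of_lt m i (by omega) hi
          rw [ax, ay]
          linarith
      · obtain ⟨i, rfl⟩ : ∃ m, i = m + c.length := ⟨i - c.length, by omega⟩
        obtain ⟨m, rfl⟩ : ∃ m, j = m + c.length := ⟨j - c.length, by omega⟩
        have := ih i (by omega) m (by omega) (by omega)
        rw [ax, ay, ax, ay]
        linarith

theorem prod_drop_take (c : List ℤ) {i j : ℕ} (hij : i ≤ j) (hj : j ≤ c.length) :
    prefixMat c i * (((c.drop i).take (j - i)).map etaM).prod = prefixMat c j := by
  rw [prefixMat_eq_take c (hij.trans hj), prefixMat_eq_take c hj, ← List.prod_append,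
    ← List.map_append, ← List.take_add, Nat.add_sub_cancel' hij]

theorem prod_drop_take_eq (c : List ℤ) {i j : ℕ} (hij : i ≤ j) (hj : j ≤ c.length) :
    (((c.drop i).take (j - i)).map etaM).prod = (prefixMat c i).adjugate * prefixMat c j := by
  rw [← prod_drop_take c hij hj, ← Matrix.mul_assoc, Matrix.adjugate_mul, det_prefixMat,
    one_smul, Matrix.one_mul]

theorem entry_drop_take (c : List ℤ) {i j : ℕ} (hij : i ≤ j) (hj : j ≤ c.length) :
    (((c.drop i).take (j - i)).map etaM).prod 1 0 =
      colX c i * colY c j - colY c i * colX c j := by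
  rw [prod_drop_take_eq c hij hj, Matrix.adjugate_fin_two]
  simp [Matrix.mul_apply, Fin.sum_univ_two, colX, colY]
  ring

theorem prod_reverse (w : List ℤ) :
    (w.reverse.map etaM).prod =
      !![1, 0; 0, -1] * ((w.map etaM).prod)ᵀ * !![1, 0; 0, -1] := by
  induction w with
  | nil => ext i j; fin_cases i <;> fin_cases j <;> simp
  | cons a w ih =>
    simp only [List.reverse_cons, List.map_append, List.prod_append, ih, List.map_cons,
      List.map_nil, List.prod_cons, List.prod_nil, Matrix.transpose_mul, mul_one]
    generalize ((w.map etaM).prod) = W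
    ext i j
    simp only [Matrix.mul_apply, Fin.sum_univ_two, Matrix.transpose_apply]
    fin_cases i <;> fin_cases j <;> simp [etaM, add_comm]

theorem Good.rotate {c : List ℤ} (h : Good c) : Good (c.rotate 1) := by
  have h2 := h.two_le
  have hrot : c.rotate 1 = c.drop 1 ++ c.take 1 :=
    List.rotate_eq_drop_append_take (by omega)
  refine ⟨by simpa, ?_, fun k h0 hk => ?_⟩
  · have e : ((c.take 1).map etaM).prod * ((c.drop 1).map etaM).prod = -1 := by
      rw [← List.prod_append, ← List.map_append, List.take_append_drop, h.prod_eq]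
    have e2 : (-((c.take 1).map etaM).prod) * ((c.drop 1).map etaM).prod = 1 := by
      rw [neg_mul, e, neg_neg]
    have := mul_eq_one_comm.1 e2
    rw [hrot, List.map_append, List.prod_append, ← neg_eq_iff_eq_neg, ← mul_neg, this]
  · rw [List.length_rotate] at hk
    rw [hrot, List.take_append_of_le_length (by simp; omega)]
    have := entry_drop_take c (i := 1) (j := k + 1) (by omega) (by omega)
    rw [Nat.add_sub_cancel] at this
    rw [this]
    exact h.frieze.det_pos 1 (k + 1) (by omega) (by omega)

theorem Good.reverse {c : List ℤ} (h : Good c) : Good c.reverse := by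
  have h2 := h.two_le
  refine ⟨by simpa, ?_, fun k h0 hk => ?_⟩
  · rw [prod_reverse, h.prod_eq]
    ext i j
    fin_cases i <;> fin_cases j <;> simp
  · rw [List.length_reverse] at hk
    obtain ⟨m, hm⟩ : ∃ m, c.length = m + 1 + k := ⟨c.length - k - 1, by omega⟩
    have e := prod_drop_take_eq c (i := m + 1) (j := c.length) (by omega) le_rfl
    have hl : (c.drop (m + 1)).take (c.length - (m + 1)) = c.drop (m + 1) :=
      List.take_of_length_le (by simp)
    obtain ⟨N, hN⟩ : ∃ N, c.length = N + 1 := ⟨c.length - 1, by omega⟩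
    have hp := h.frieze.det_pos m N (by omega) (by omega)
    rw [hl, prefixMat_succ, hN, prefixMat_succ, Matrix.adjugate_fin_two] at e
    rw [List.take_reverse, show c.length - k = m + 1 by omega, prod_reverse, e]
    simp only [Matrix.mul_apply, Fin.sum_univ_two, Matrix.transpose_apply]
    simp
    linarith

theorem Good.expand {a b : ℤ} {t : List ℤ} (h : Good (a :: b :: t)) :
    Good ((a + 1) :: 1 :: (b + 1) :: t) := by
  have key : etaM (a + 1) * (etaM 1 * etaM (b + 1)) = etaM a * etaM b := by
    ext i j
    fin_cases i <;> fin_cases j <;> simp [etaM, Matrix.mul_apply, Fin.sum_univ_two]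
    ring
  have hprod (w : List ℤ) : (((a + 1) :: 1 :: (b + 1) :: w).map etaM).prod =
      ((a :: b :: w).map etaM).prod := by
    simp only [List.map_cons, List.prod_cons, ← Matrix.mul_assoc]
    rw [← key]
    simp only [Matrix.mul_assoc]
  refine ⟨by simp, by rw [hprod, h.prod_eq], fun k h0 hk => ?_⟩
  match k, h0, hk with
  | 1, _, _ => simp [etaM]
  | 2, _, _ => simp [etaM, Matrix.mul_apply, Fin.sum_univ_two]
  | k + 3, _, hk =>
    have := h.pos (k + 2) (by omega) (by simp at hk ⊢; omega)
    simp only [List.take_succ_cons] at this ⊢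
    rwa [hprod]

theorem good_of_isEta {c : List ℤ} (h : IsEta c) : Good c := by
  induction h with
  | base =>
    refine ⟨by simp, ?_, fun k h0 hk => ?_⟩
    · ext i j
      fin_cases i <;> fin_cases j <;> simp [etaM]
    · obtain rfl : k = 1 := by simp at hk; omega
      simp [etaM]
  | rotate _ ih => exact ih.rotate
  | reverse _ ih => exact ih.reverse
  | expand _ ih => exact ih.expand

theorem Good.phi_eq {c : List ℤ} (h : Good c) {i j : ℕ} (hi : i < c.length)
    (hj : j < c.length) :
    phi c (i + 1) (j + 1) = |colX c i * colY c j - colY c i * colX c j| := by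
  unfold phi
  simp only [Nat.add_right_cancel_iff, Nat.add_lt_add_iff_right, Nat.add_sub_cancel,
    Nat.add_sub_add_right]
  split_ifs with h1 h2
  · subst h1; rw [mul_comm]; simp
  · rw [entry_drop_take c h2.le hj.le, abs_of_pos (h.det_pos_of_lt i j h2 hj)]
  · rw [entry_drop_take c (by omega) hi.le, abs_of_neg]
    · ring
    · have := h.det_pos_of_lt j i (by omega) hi
      linarith

theorem Good.mem_mset {c : List ℤ} (h : Good c) {i j : ℕ} (hi : i < c.length) :
    j + 1 ∈ mset c (i + 1) ↔ j < c.length ∧ MaxAt (colX c) (colY c) i j := by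
  simp only [mset, Finset.mem_filter, Finset.mem_Icc]
  constructor
  · rintro ⟨h1, h2⟩
    refine ⟨by omega, fun l => ?_⟩
    have hl : l % c.length < c.length := Nat.mod_lt _ (by omega)
    have := h2 (l % c.length + 1) ⟨by omega, by omega⟩
    rwa [h.phi_eq hi hl, h.phi_eq hi (by omega), h.frieze.abs_det_mod] at this
  · rintro ⟨h1, h2⟩
    refine ⟨by omega, fun l hl => ?_⟩
    obtain ⟨l, rfl⟩ : ∃ m, l = m + 1 := ⟨l - 1, by omega⟩
    rw [h.phi_eq hi (by omega), h.phi_eq hi h1]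
    exact h2 l

/-- The representative of position `a` in the window following `i`. -/
theorem Good.maxAt_window {c : List ℤ} (h : Good c) {i a : ℕ} (hi : i < c.length)
    (ha : a < c.length) (m : MaxAt (colX c) (colY c) i a) :
    ∃ l, i < l ∧ l < i + c.length ∧ MaxAt (colX c) (colY c) i l ∧
      (l = a ∨ l = a + c.length) := by
  rcases lt_trichotomy i a with hlt | rfl | hgt
  · exact ⟨a, hlt, by omega, m, Or.inl rfl⟩
  · exact (h.frieze.not_maxAt_self _ m).elim
  · exact ⟨a + c.length, by omega, by omega, (h.frieze.maxAt_add_right _ _).2 m, Or.inr rfl⟩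

theorem Good.multi_of_card {c : List ℤ} (h : Good c) {i : ℕ} (hi : i < c.length)
    (hc : 1 < (mset c (i + 1)).card) : Multi c.length (colX c) (colY c) i := by
  obtain ⟨a, ha, b, hb, hab⟩ := Finset.one_lt_card.1 hc
  have pos {a : ℕ} (ha : a ∈ mset c (i + 1)) : ∃ a', a = a' + 1 := by
    simp only [mset, Finset.mem_filter, Finset.mem_Icc] at ha
    exact ⟨a - 1, by omega⟩
  obtain ⟨a, rfl⟩ := pos ha
  obtain ⟨b, rfl⟩ := pos hb
  rw [h.mem_mset hi] at ha hb
  obtain ⟨l, l1, l2, l3, l4⟩ := h.maxAt_window hi ha.1 ha.2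
  obtain ⟨k, k1, k2, k3, k4⟩ := h.maxAt_window hi hb.1 hb.2
  rcases lt_trichotomy l k with hlt | heq | hgt
  · exact ⟨l, k, l1, hlt, k2, l3, k3⟩
  · omega
  · exact ⟨k, l, k1, hgt, l2, k3, l3⟩

theorem Good.multi_of_dense {c : List ℤ} (h : Good c) (hd : DenseSeq c) (i : ℕ)
    (hi : i < c.length) :
    Multi c.length (colX c) (colY c) i ∨ Multi c.length (colX c) (colY c) (i + 1) := by
  have h2 := h.two_le
  refine (hd (i + 1) (by simp; omega)).imp (h.multi_of_card hi) fun hc => ?_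
  unfold addIdx at hc
  split_ifs at hc with hle
  · exact h.multi_of_card (by omega) hc
  · rw [show i + 1 + 1 - c.length = 0 + 1 by omega] at hc
    have := h.frieze.multi_add.2 (h.multi_of_card (by omega) hc)
    rwa [show i + 1 = 0 + c.length by omega]

theorem Good.mset_of_multi {c : List ℤ} (h : Good c) (hd : DenseSeq c) (hn : 4 < c.length)
    {i j e : ℕ} (hi : i < c.length) (he : e < c.length) (hj : j = e ∨ j = e + c.length)
    (hf : FirstMax c.length (colX c) (colY c) i j)
    (m : Multi c.length (colX c) (colY c) i) :
    mset c (i + 1) = {e + 1, addIdx c.length (e + 1) 2} := by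
  obtain ⟨hlt, hmax⟩ := h.frieze.maxAt_iff_of_multi hn (h.multi_of_dense hd) hi hf m
  have hm1 : MaxAt (colX c) (colY c) i e := by
    rcases hj with rfl | rfl
    · exact hf.2.2.1
    · exact (h.frieze.maxAt_add_right _ _).1 hf.2.2.1
  have hm2 : MaxAt (colX c) (colY c) i (e + 2) := by
    have := (hmax (j + 2) (by have := hf.1; omega) hlt).2 (Or.inr rfl)
    rcases hj with rfl | rfl
    · exact this
    · rw [add_right_comm] at this
      exact (h.frieze.maxAt_add_right _ _).1 this
  ext q
  simp only [Finset.mem_insert, Finset.mem_singleton]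
  constructor
  · intro hq
    obtain ⟨q, rfl⟩ : ∃ q', q = q' + 1 := by
      simp only [mset, Finset.mem_filter, Finset.mem_Icc] at hq
      exact ⟨q - 1, by omega⟩
    rw [h.mem_mset hi] at hq
    obtain ⟨l, l1, l2, l3, l4⟩ := h.maxAt_window hi hq.1 hq.2
    have := (hmax l l1 l2).1 l3
    unfold addIdx
    split_ifs <;> omega
  · rintro (rfl | rfl)
    · exact (h.mem_mset hi).2 ⟨he, hm1⟩
    · unfold addIdx
      split_ifs with hle
      · exact (h.mem_mset hi (j := e + 2)).2 ⟨by omega, hm2⟩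
      · rw [show e + 1 + 2 - c.length = (e + 2 - c.length) + 1 by omega]
        refine (h.mem_mset hi).2 ⟨by omega, ?_⟩
        rwa [← h.frieze.maxAt_add_right, Nat.sub_add_cancel (by omega)]

theorem Good.mset_of_not_multi {c : List ℤ} (h : Good c)
    {i j e : ℕ} (hi : i < c.length) (he : e < c.length) (hj : j = e ∨ j = e + c.length)
    (hf : FirstMax c.length (colX c) (colY c) i j)
    (m : ¬ Multi c.length (colX c) (colY c) i) :
    mset c (i + 1) = {e + 1} := by
  have hm1 : MaxAt (colX c) (colY c) i e := by
    rcases hj with rfl | rfl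
    · exact hf.2.2.1
    · exact (h.frieze.maxAt_add_right _ _).1 hf.2.2.1
  ext q
  rw [Finset.mem_singleton]
  constructor
  · intro hq
    obtain ⟨q, rfl⟩ : ∃ q', q = q' + 1 := by
      simp only [mset, Finset.mem_filter, Finset.mem_Icc] at hq
      exact ⟨q - 1, by omega⟩
    rw [h.mem_mset hi] at hq
    obtain ⟨l, l1, l2, l3, l4⟩ := h.maxAt_window hi hq.1 hq.2
    have := (maxAt_iff_of_not_multi hf m l l1 l2).1 l3
    omega
  · rintro rfl
    exact (h.mem_mset hi).2 ⟨he, hm1⟩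

end EtaSeq

theorem dense_mset_structure (c : List ℤ) (h : IsEta c) (hd : DenseSeq c)
    (hn : 4 < c.length) :
    (∀ i ∈ Finset.Icc 1 c.length, ∃ e ∈ Finset.Icc 1 c.length, entryOf c e = 1 ∧
       (mset c i = {e} ∨ mset c i = {e, addIdx c.length e 2})) ∧
    (∀ e ∈ Finset.Icc 1 c.length, entryOf c e = 1 →
       ∃ i ∈ Finset.Icc 1 c.length, mset c i = {e, addIdx c.length e 2}) := by
  have g := EtaSeq.good_of_isEta h
  constructor
  · intro i hi
    rw [Finset.mem_Icc] at hi
    obtain ⟨i, rfl⟩ : ∃ k, i = k + 1 := ⟨i - 1, by omega⟩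
    have hin : i < c.length := by omega
    obtain ⟨j, hf⟩ := g.frieze.exists_firstMax (by omega) i
    have hear : c.getD (j % c.length) 0 = 1 := g.frieze.ear_of_firstMax (by omega) hf
    obtain ⟨e, he, hj⟩ : ∃ e, e < c.length ∧ (j = e ∨ j = e + c.length) := by
      have := hf.2.1
      rcases lt_or_ge j c.length with hlt | hge
      · exact ⟨j, hlt, Or.inl rfl⟩
      · exact ⟨j - c.length, by omega, by omega⟩
    have hmod : j % c.length = e := by
      rcases hj with rfl | rfl
      · exact Nat.mod_eq_of_lt he
      · rw [Nat.add_mod_right, Nat.mod_eq_of_lt he]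
    rw [hmod] at hear
    refine ⟨e + 1, by rw [Finset.mem_Icc]; omega, hear, ?_⟩
    by_cases m : EtaSeq.Multi c.length (EtaSeq.colX c) (EtaSeq.colY c) i
    · exact Or.inr (g.mset_of_multi hd hn hin he hj hf m)
    · exact Or.inl (g.mset_of_not_multi hin he hj hf m)
  · intro e he hear
    rw [Finset.mem_Icc] at he
    obtain ⟨e, rfl⟩ : ∃ k, e = k + 1 := ⟨e - 1, by omega⟩
    have hen : e < c.length := by omega
    obtain ⟨i, hi, m, hf⟩ := (g.frieze.dense_structure hn (g.multi_of_dense hd)).2 e hen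
      (by rw [Nat.mod_eq_of_lt hen]; exact hear)
    refine ⟨i + 1, by rw [Finset.mem_Icc]; omega, ?_⟩
    rcases hf with hf | hf
    · exact g.mset_of_multi hd hn hi hen (Or.inl rfl) hf m
    · exact g.mset_of_multi hd hn hi hen (Or.inr rfl) hf m
end
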